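/- arXiv:2201.00547 — 7 statements merged into one kernel-verified Lean document; each statement's English description precedes it below -/
import Mathlib

section
/- For every even integer k ≥ 4 and every integer n ≥ k, every set A of n distinct real numbers satisfying the (k, 3k²/8 − 3k/4 + 2)-local property has |A - A| > (1/k)·(n(n-1)/2). (That is, g(n, k, 3k²/8 − 3k/4 + 2) = Ω(n²).) -/
open Finset Pointwise

/-- The (positive) difference set of a finite set of reals:
`A - A = {a - a' : a, a' ∈ A, a - a' > 0}`. -/
noncomputable def diffSet (A : Finset ℝ) : Finset ℝ := (A - A).filter (fun x => 0 < x)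

/-- `A` satisfies the `(k, ℓ)`-local property: every `k`-element subset `A'` of `A`
spans at least `ℓ` positive differences. -/
def LocalProp (A : Finset ℝ) (k ℓ : ℕ) : Prop :=
  ∀ A' ⊆ A, A'.card = k → ℓ ≤ (diffSet A').card

/-- The pairs of elements of `S` in increasing order. -/
noncomputable def ltPairs (S : Finset ℝ) : Finset (ℝ × ℝ) :=
  (S ×ˢ S).filter (fun p => p.1 < p.2)

lemma mem_ltPairs {S : Finset ℝ} {p : ℝ × ℝ} :
    p ∈ ltPairs S ↔ p.1 ∈ S ∧ p.2 ∈ S ∧ p.1 < p.2 := by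
  simp [ltPairs, and_assoc]

lemma two_mul_card_ltPairs (S : Finset ℝ) : 2 * #(ltPairs S) + #S = #S * #S := by
  have hswap : #((ltPairs S).image Prod.swap) = #(ltPairs S) :=
    card_image_of_injective _ Prod.swap_injective
  have hunion : S.offDiag = ltPairs S ∪ (ltPairs S).image Prod.swap := by
    ext ⟨x, y⟩
    simp only [mem_offDiag, mem_union, mem_image, mem_ltPairs, Prod.exists, Prod.swap_prod_mk,
      Prod.mk.injEq]
    constructor
    · rintro ⟨hx, hy, hne⟩
      rcases lt_or_gt_of_ne hne with h | h
      · exact Or.inl ⟨hx, hy, h⟩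
      · exact Or.inr ⟨y, x, ⟨hy, hx, h⟩, rfl, rfl⟩
    · rintro (⟨hx, hy, h⟩ | ⟨a, b, ⟨ha, hb, h⟩, rfl, rfl⟩)
      · exact ⟨hx, hy, h.ne⟩
      · exact ⟨hb, ha, h.ne'⟩
  have hdisj : Disjoint (ltPairs S) ((ltPairs S).image Prod.swap) := by
    rw [Finset.disjoint_left]
    rintro ⟨x, y⟩ h h'
    simp only [mem_image, mem_ltPairs, Prod.exists, Prod.swap_prod_mk, Prod.mk.injEq] at h h'
    obtain ⟨a, b, ⟨-, -, hab⟩, rfl, rfl⟩ := h'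
    exact lt_asymm hab h.2.2
  have hcard := S.offDiag_card
  rw [hunion, card_union_of_disjoint hdisj, hswap] at hcard
  have := Nat.le_mul_self #S
  omega

/-- At least half of the elements of `S` can be chosen with no two of them differing by `d`. -/
lemma exists_subset_add_notMem {d : ℝ} (hd : 0 < d) (S : Finset ℝ) :
    ∃ T ⊆ S, #S ≤ 2 * #T ∧ ∀ x ∈ T, x + d ∉ T := by
  induction S using Finset.strongInduction with
  | H S ih =>
    rcases S.eq_empty_or_nonempty with rfl | hS
    · exact ⟨∅, by simp⟩
    set x := S.min' hS
    have hx : x ∈ S := S.min'_mem hS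
    have hss : (S.erase x).erase (x + d) ⊂ S :=
      (erase_subset _ _).trans_ssubset (erase_ssubset hx)
    obtain ⟨T, hTS, hcard, hT⟩ := ih _ hss
    have hxT : x ∉ T := fun h => by simpa using hTS h
    have hxdT : x + d ∉ T := fun h => by simpa using hTS h
    refine ⟨insert x T, insert_subset hx (hTS.trans hss.subset), ?_, ?_⟩
    · rw [card_insert_of_notMem hxT]
      have h1 := card_erase_of_mem hx
      have h2 := pred_card_le_card_erase (s := S.erase x) (a := x + d)
      omega
    · intro y hy hyd
      rw [mem_insert] at hy hyd
      rcases hy with rfl | hy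
      · rcases hyd with h | h
        · linarith
        · exact hxdT h
      · rcases hyd with h | h
        · have := S.min'_le y (hss.subset (hTS hy))
          change x ≤ y at this
          linarith
        · exact hT y hy h

lemma card_diffSet_union_translate_le {d : ℝ} (hd : 0 < d) (T : Finset ℝ) :
    #(diffSet (T ∪ T.image (· + d))) ≤ 3 * #(ltPairs T) + 1 := by
  have hsub : diffSet (T ∪ T.image (· + d)) ⊆
      insert d ((ltPairs T).image (fun p => p.2 - p.1) ∪
        (ltPairs T).image (fun p => p.2 - p.1 + d) ∪
        (ltPairs T).image (fun p => |p.2 - p.1 - d|)) := by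
    intro z hz
    obtain ⟨hz, hpos⟩ := mem_filter.1 hz
    obtain ⟨u, hu, v, hv, rfl⟩ := mem_sub.1 hz
    have key : ∃ x ∈ T, ∃ y ∈ T,
        u - v = y - x ∨ u - v = y - x + d ∨ u - v = y - x - d := by
      simp only [mem_union, mem_image] at hu hv
      rcases hu with hu | ⟨u, hu, rfl⟩ <;> rcases hv with hv | ⟨v, hv, rfl⟩ <;>
        refine ⟨v, hv, u, hu, ?_⟩
      · exact Or.inl rfl
      · exact Or.inr (Or.inr (by ring))
      · exact Or.inr (Or.inl (by ring))
      · exact Or.inl (by ring)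
    obtain ⟨x, hx, y, hy, h⟩ := key
    simp only [mem_insert, mem_union, mem_image]
    rcases lt_trichotomy x y with hxy | rfl | hxy
    · have hp : (x, y) ∈ ltPairs T := mem_ltPairs.2 ⟨hx, hy, hxy⟩
      rcases h with h | h | h
      · exact Or.inr (Or.inl (Or.inl ⟨_, hp, h.symm⟩))
      · exact Or.inr (Or.inl (Or.inr ⟨_, hp, h.symm⟩))
      · refine Or.inr (Or.inr ⟨_, hp, ?_⟩)
        rw [h] at hpos ⊢
        exact abs_of_pos hpos
    · left
      rcases h with h | h | h <;> linarith
    · rcases h with h | h | h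
      · linarith
      · refine Or.inr (Or.inr ⟨(y, x), mem_ltPairs.2 ⟨hy, hx, hxy⟩, ?_⟩)
        rw [h] at hpos ⊢
        rw [abs_of_neg] <;> linarith
      · linarith
  refine (card_le_card hsub).trans ((card_insert_le _ _).trans ?_)
  have h1 := card_union_le ((ltPairs T).image (fun p => p.2 - p.1) ∪
    (ltPairs T).image (fun p => p.2 - p.1 + d)) ((ltPairs T).image (fun p => |p.2 - p.1 - d|))
  have h2 := card_union_le ((ltPairs T).image (fun p => p.2 - p.1))
    ((ltPairs T).image (fun p => p.2 - p.1 + d))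
  have h3 := card_image_le (s := ltPairs T) (f := fun p => p.2 - p.1)
  have h4 := card_image_le (s := ltPairs T) (f := fun p => p.2 - p.1 + d)
  have h5 := card_image_le (s := ltPairs T) (f := fun p => |p.2 - p.1 - d|)
  omega

/-- If `A` has few differences compared to its number of pairs, some difference is popular. -/
lemma exists_popular_difference {A : Finset ℝ} (hA : 2 ≤ #A) {k : ℕ}
    (h : #(diffSet A) * k ≤ #(ltPairs A)) :
    ∃ d : ℝ, 0 < d ∧ k ≤ #(A.filter (fun x => x + d ∈ A)) := by
  have hmaps : ∀ p ∈ ltPairs A, p.2 - p.1 ∈ diffSet A := fun p hp => by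
    obtain ⟨h1, h2, h3⟩ := mem_ltPairs.1 hp
    exact mem_filter.2 ⟨sub_mem_sub h2 h1, sub_pos.2 h3⟩
  have hne : (ltPairs A).Nonempty := by
    rw [← card_pos]
    have := two_mul_card_ltPairs A
    nlinarith
  obtain ⟨d, hd, hcard⟩ := exists_le_card_fiber_of_mul_le_card_of_maps_to hmaps
    (hne.elim fun p hp => ⟨_, hmaps p hp⟩) h
  refine ⟨d, (mem_filter.1 hd).2, hcard.trans ?_⟩
  refine card_le_card_of_injOn Prod.fst ?_ ?_
  · intro p hp
    obtain ⟨hpA, rfl⟩ := mem_filter.1 hp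
    obtain ⟨h1, h2, -⟩ := mem_ltPairs.1 hpA
    simp [h1, h2]
  · intro p hp q hq hpq
    have h1 := (mem_filter.1 hp).2
    have h2 := (mem_filter.1 hq).2
    exact Prod.ext hpq (by linarith)

/-- `g(n, k, 3k²/8 − 3k/4 + 2) = Ω(n²)` for even `k`: every `n`-element set with the
corresponding local property has more than `(1/k)·(n(n-1)/2)` positive differences. -/
theorem g_quadratic (k ℓ n : ℕ) (hk : 4 ≤ k) (hke : Even k) (hn : k ≤ n)
    (hℓ : (ℓ : ℚ) = 3 * k ^ 2 / 8 - 3 * k / 4 + 2) :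
    ∀ A : Finset ℝ, A.card = n → LocalProp A k ℓ →
      (1 / (k : ℝ)) * ((n : ℝ) * ((n : ℝ) - 1) / 2) < (diffSet A).card := by
  intro A hA hloc
  by_contra! hcon
  have hkpos : (0 : ℝ) < k := by positivity
  have hpairs := two_mul_card_ltPairs A
  rw [hA] at hpairs
  have hpop : #(diffSet A) * k ≤ #(ltPairs A) := by
    have hpairs' : 2 * (#(ltPairs A) : ℝ) + n = n * n := by exact_mod_cast hpairs
    rw [one_div, inv_mul_eq_div, le_div_iff₀ hkpos] at hcon
    have : (#(diffSet A) : ℝ) * k ≤ #(ltPairs A) := by linarith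
    exact_mod_cast this
  obtain ⟨d, hd, hS⟩ := exists_popular_difference (by omega) hpop
  obtain ⟨T', hT'S, hT'card, hT'⟩ :=
    exists_subset_add_notMem hd (A.filter (fun x => x + d ∈ A))
  obtain ⟨m, rfl⟩ := hke
  obtain ⟨T, hTT', hT⟩ := exists_subset_card_eq (show m ≤ #T' by omega)
  have hdisj : Disjoint T (T.image (· + d)) := by
    rw [Finset.disjoint_left]
    intro x hx hx'
    obtain ⟨y, hy, rfl⟩ := mem_image.1 hx'
    exact hT' y (hTT' hy) (hTT' hx)
  have hle := hloc (T ∪ T.image (· + d))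
    (union_subset (fun x hx => (mem_filter.1 (hT'S (hTT' hx))).1) fun x hx => by
      obtain ⟨y, hy, rfl⟩ := mem_image.1 hx
      exact (mem_filter.1 (hT'S (hTT' hy))).2)
    (by rw [card_union_of_disjoint hdisj, card_image_of_injective _ (add_left_injective d), hT])
  have hlt := hle.trans (card_diffSet_union_translate_le hd T)
  have hTpairs := two_mul_card_ltPairs T
  rw [hT] at hTpairs
  have h1 : (ℓ : ℚ) ≤ 3 * #(ltPairs T) + 1 := by exact_mod_cast hlt
  have h2 : 2 * (#(ltPairs T) : ℚ) + m = m * m := by exact_mod_cast hTpairs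
  push_cast at hℓ
  nlinarith
end

section
/- For every even integer ℓ ≥ 2 there exist constants c₁, c₂ > 0 such that every set A of n ≥ 2 distinct real numbers satisfies at least one of: (i) |A - A| ≥ c₁ · n^{4/3}, or (ii) E^D_ℓ(A) ≥ c₂ · n^{4ℓ} / |A - A|^{3ℓ - 2}. -/
open Finset Pointwise

/-- `r^D_A(d,d')`: the number of dumbbells `(a₁,a₂,a₃,a₄) ∈ A⁴` in the congruence class
`D(d,d')`, i.e. with `a₁ < a₂ < a₃ < a₄`, `a₂ - a₁ = a₄ - a₃ = d` and `a₃ - a₂ = d'`. -/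
noncomputable def rD (A : Finset ℝ) (d d' : ℝ) : ℕ :=
  ((A ×ˢ A ×ˢ A ×ˢ A).filter fun q =>
    q.1 < q.2.1 ∧ q.2.1 < q.2.2.1 ∧ q.2.2.1 < q.2.2.2 ∧
    q.2.1 - q.1 = d ∧ q.2.2.2 - q.2.2.1 = d ∧ q.2.2.1 - q.2.1 = d').card

/-- The `ℓ`-th dumbbell energy `E^D_ℓ(A) = Σ_{d,d' ∈ A−A} C(r^D_A(d,d'), ℓ)`,
which counts `4ℓ`-tuples from `A` forming `ℓ` distinct pairwise congruent dumbbells. -/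
noncomputable def ED (A : Finset ℝ) (ℓ : ℕ) : ℕ :=
  ∑ p ∈ diffSet A ×ˢ diffSet A, (rD A p.1 p.2).choose ℓ

/-- The pairs `a < b` of elements of `A`. -/
noncomputable def orderedPairs (A : Finset ℝ) : Finset (ℝ × ℝ) :=
  (A ×ˢ A).filter fun p => p.1 < p.2

/-- The quadruples `(a, b, c, e)` in `A` with `a < b`, `c < e` and `b - a = e - c`. -/
noncomputable def equalGapQuads (A : Finset ℝ) : Finset (ℝ × ℝ × ℝ × ℝ) :=
  (A ×ˢ A ×ˢ A ×ˢ A).filter fun q =>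
    q.1 < q.2.1 ∧ q.2.2.1 < q.2.2.2 ∧ q.2.1 - q.1 = q.2.2.2 - q.2.2.1

/-- The dumbbells with all four points in `A`. -/
noncomputable def dumbbells (A : Finset ℝ) : Finset (ℝ × ℝ × ℝ × ℝ) :=
  (A ×ˢ A ×ˢ A ×ˢ A).filter fun q =>
    q.1 < q.2.1 ∧ q.2.1 < q.2.2.1 ∧ q.2.2.1 < q.2.2.2 ∧ q.2.1 - q.1 = q.2.2.2 - q.2.2.1

theorem sub_mem_diffSet {A : Finset ℝ} {a b : ℝ} (ha : a ∈ A) (hb : b ∈ A) (hab : a < b) :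
    b - a ∈ diffSet A :=
  mem_filter.2 ⟨sub_mem_sub hb ha, sub_pos.2 hab⟩

theorem card_sq_le_four_mul_card_orderedPairs {A : Finset ℝ} (hA : 2 ≤ A.card) :
    A.card ^ 2 ≤ 4 * (orderedPairs A).card := by
  have hsub : A ×ˢ A ⊆ orderedPairs A ∪ (orderedPairs A).image Prod.swap ∪
      A.image (fun x => (x, x)) := by
    rintro ⟨a, b⟩ h
    obtain ⟨ha, hb⟩ := mem_product.1 h
    rcases lt_trichotomy a b with hlt | rfl | hlt
    · simp_all [orderedPairs]
    · simp_all
    · simp_all [orderedPairs]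
  have h := card_le_card hsub
  have h1 := card_union_le (orderedPairs A ∪ (orderedPairs A).image Prod.swap)
    (A.image fun x => (x, x))
  have h2 := card_union_le (orderedPairs A) ((orderedPairs A).image Prod.swap)
  have h3 := card_image_le (s := orderedPairs A) (f := Prod.swap)
  have h4 := card_image_le (s := A) (f := fun x => (x, x))
  rw [card_product] at h
  nlinarith

theorem sq_card_orderedPairs_le (A : Finset ℝ) :
    (orderedPairs A).card ^ 2 ≤ (diffSet A).card * (equalGapQuads A).card := by
  have hP : (orderedPairs A).card =
      ∑ d ∈ diffSet A, ((orderedPairs A).filter fun p => p.2 - p.1 = d).card := by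
    refine card_eq_sum_card_fiberwise fun p hp => ?_
    obtain ⟨hp, hlt⟩ := mem_filter.1 hp
    exact sub_mem_diffSet (mem_product.1 hp).1 (mem_product.1 hp).2 hlt
  have hQ : (equalGapQuads A).card =
      ∑ d ∈ diffSet A, ((orderedPairs A).filter fun p => p.2 - p.1 = d).card ^ 2 := by
    rw [card_eq_sum_card_fiberwise (t := diffSet A) (f := fun q => q.2.1 - q.1)]
    · refine sum_congr rfl fun d _ => ?_
      rw [sq, ← card_product]
      refine card_nbij' (fun q => ((q.1, q.2.1), (q.2.2.1, q.2.2.2)))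
        (fun r => (r.1.1, r.1.2, r.2.1, r.2.2)) ?_ ?_ ?_ ?_
      · rintro ⟨a, b, c, e⟩ h
        simp only [equalGapQuads, orderedPairs, coe_filter, mem_filter, mem_product,
          Set.mem_ofPred_eq, SetLike.mem_coe] at h ⊢
        obtain ⟨⟨⟨ha, hb, hc, he⟩, h1, h2, h3⟩, h4⟩ := h
        exact ⟨⟨⟨⟨ha, hb⟩, h1⟩, h4⟩, ⟨⟨hc, he⟩, h2⟩, h3 ▸ h4⟩
      · rintro ⟨⟨a, b⟩, c, e⟩ h
        simp only [equalGapQuads, orderedPairs, coe_filter, mem_filter, mem_product,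
          Set.mem_ofPred_eq, SetLike.mem_coe] at h ⊢
        obtain ⟨⟨⟨⟨ha, hb⟩, h1⟩, h4⟩, ⟨⟨hc, he⟩, h2⟩, h3⟩ := h
        exact ⟨⟨⟨ha, hb, hc, he⟩, h1, h2, h4.trans h3.symm⟩, h4⟩
      · intro q _
        rfl
      · intro r _
        rfl
    · intro q hq
      obtain ⟨hq, hlt, -⟩ := mem_filter.1 hq
      simp only [mem_product] at hq
      exact sub_mem_diffSet hq.1 hq.2.1 hlt
  rw [hP, hQ]
  exact sq_sum_le_card_mul_sum_sq

/-- Two intervals of equal length with endpoints in `A` are disjoint, share an endpoint, coincide,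
or overlap; in the last case exchanging the two middle points gives a dumbbell. -/
theorem card_equalGapQuads_le (A : Finset ℝ) :
    (equalGapQuads A).card ≤ 4 * (dumbbells A).card + 3 * A.card ^ 2 := by
  have hsub : equalGapQuads A ⊆
      (dumbbells A ∪ (dumbbells A).image (fun q => (q.1, q.2.2.1, q.2.1, q.2.2.2)) ∪
        (dumbbells A).image (fun q => (q.2.2.1, q.2.2.2, q.1, q.2.1)) ∪
        (dumbbells A).image (fun q => (q.2.1, q.2.2.2, q.1, q.2.2.1))) ∪
      ((A ×ˢ A).image (fun p => (p.1, p.2, p.1, p.2)) ∪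
        (A ×ˢ A).image (fun p => (p.1, p.2, p.2, 2 * p.2 - p.1)) ∪
        (A ×ˢ A).image (fun p => (p.1, p.2, 2 * p.1 - p.2, p.1))) := by
    rintro ⟨a, b, c, e⟩ h
    simp only [equalGapQuads, mem_filter, mem_product] at h
    obtain ⟨⟨ha, hb, hc, he⟩, h1, h2, h3⟩ := h
    simp only [dumbbells, mem_union, mem_image, mem_filter, mem_product, Prod.exists,
      Prod.mk.injEq]
    rcases lt_trichotomy a c with hac | rfl | hac
    · rcases lt_trichotomy b c with hbc | rfl | hbc
      · exact .inl (.inl (.inl (.inl ⟨⟨ha, hb, hc, he⟩, h1, hbc, h2, h3⟩)))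
      · exact .inr (.inl (.inr ⟨a, b, ⟨ha, hb⟩, rfl, rfl, rfl, by linarith⟩))
      · exact .inl (.inl (.inl (.inr ⟨a, c, b, e,
          ⟨⟨ha, hc, hb, he⟩, hac, hbc, by linarith, by linarith⟩, rfl, rfl, rfl, rfl⟩)))
    · exact .inr (.inl (.inl ⟨a, b, ⟨ha, hb⟩, rfl, rfl, rfl, by linarith⟩))
    · rcases lt_trichotomy e a with hea | rfl | hea
      · exact .inl (.inl (.inr ⟨c, e, a, b, ⟨⟨hc, he, ha, hb⟩, h2, hea, h1, h3.symm⟩,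
          rfl, rfl, rfl, rfl⟩))
      · exact .inr (.inr ⟨e, b, ⟨ha, hb⟩, rfl, rfl, by linarith, rfl⟩)
      · exact .inl (.inr ⟨c, a, e, b, ⟨⟨hc, ha, he, hb⟩, hac, hea, by linarith, by linarith⟩,
          rfl, rfl, rfl, rfl⟩)
  have hD (f : ℝ × ℝ × ℝ × ℝ → ℝ × ℝ × ℝ × ℝ) :
      ((dumbbells A).image f).card ≤ (dumbbells A).card := card_image_le
  have hAA (f : ℝ × ℝ → ℝ × ℝ × ℝ × ℝ) : ((A ×ˢ A).image f).card ≤ A.card ^ 2 := by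
    rw [sq, ← card_product]
    exact card_image_le
  calc (equalGapQuads A).card ≤ _ := card_le_card hsub
    _ ≤ ((dumbbells A).card + (dumbbells A).card + (dumbbells A).card + (dumbbells A).card) +
        (A.card ^ 2 + A.card ^ 2 + A.card ^ 2) := by
      refine (card_union_le _ _).trans (Nat.add_le_add ?_ ?_)
      · refine (card_union_le _ _).trans (Nat.add_le_add ?_ (hD _))
        refine (card_union_le _ _).trans (Nat.add_le_add ?_ (hD _))
        exact (card_union_le _ _).trans (Nat.add_le_add le_rfl (hD _))
      · refine (card_union_le _ _).trans (Nat.add_le_add ?_ (hAA _))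
        exact (card_union_le _ _).trans (Nat.add_le_add (hAA _) (hAA _))
    _ = _ := by ring

theorem card_dumbbells (A : Finset ℝ) :
    (dumbbells A).card = ∑ p ∈ diffSet A ×ˢ diffSet A, rD A p.1 p.2 := by
  rw [card_eq_sum_card_fiberwise (t := diffSet A ×ˢ diffSet A)
    (f := fun q => (q.2.1 - q.1, q.2.2.1 - q.2.1))]
  · refine sum_congr rfl fun p _ => ?_
    rw [rD, dumbbells, filter_filter]
    congr 1
    refine filter_congr fun q _ => ?_
    constructor
    · rintro ⟨⟨h1, h2, h3, h4⟩, rfl⟩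
      exact ⟨h1, h2, h3, rfl, h4.symm, rfl⟩
    · rintro ⟨h1, h2, h3, h4, h5, h6⟩
      exact ⟨⟨h1, h2, h3, h4.trans h5.symm⟩, Prod.ext h4 h6⟩
  · intro q hq
    obtain ⟨hq, h1, h2, -⟩ := mem_filter.1 hq
    simp only [mem_product] at hq
    exact mem_product.2 ⟨sub_mem_diffSet hq.1 hq.2.1 h1, sub_mem_diffSet hq.2.1 hq.2.2.1 h2⟩

/-- The number of dumbbells is at least of order `n ^ 4 / |A - A|`, up to an `O(n ^ 2)` error. -/
theorem card_pow_four_le (A : Finset ℝ) (hA : 2 ≤ A.card) :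
    A.card ^ 4 ≤ 16 * (diffSet A).card * (4 * (dumbbells A).card + 3 * A.card ^ 2) :=
  calc A.card ^ 4 = (A.card ^ 2) ^ 2 := by ring
    _ ≤ (4 * (orderedPairs A).card) ^ 2 :=
      Nat.pow_le_pow_left (card_sq_le_four_mul_card_orderedPairs hA) 2
    _ = 16 * (orderedPairs A).card ^ 2 := by ring
    _ ≤ 16 * ((diffSet A).card * (equalGapQuads A).card) :=
      Nat.mul_le_mul_left _ (sq_card_orderedPairs_le A)
    _ ≤ 16 * ((diffSet A).card * (4 * (dumbbells A).card + 3 * A.card ^ 2)) :=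
      Nat.mul_le_mul_left _ (Nat.mul_le_mul_left _ (card_equalGapQuads_le A))
    _ = _ := by ring

theorem sub_pow_le_factorial_mul_choose (r ℓ : ℕ) : (r - ℓ) ^ ℓ ≤ ℓ.factorial * r.choose ℓ :=
  calc (r - ℓ) ^ ℓ ≤ (r + 1 - ℓ) ^ ℓ := Nat.pow_le_pow_left (by omega) ℓ
    _ ≤ r.descFactorial ℓ := Nat.pow_sub_le_descFactorial r ℓ
    _ = _ := Nat.descFactorial_eq_factorial_mul_choose r ℓ

/-- A power-mean lower bound for sums of binomial coefficients. -/
theorem pow_le_mul_sum_choose {ι : Type*} (s : Finset ι) (r : ι → ℕ) (m : ℕ) {X : ℝ} (hX : 0 ≤ X)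
    (h : X + (m + 1) * s.card ≤ ∑ i ∈ s, (r i : ℝ)) :
    X ^ (m + 1) / (s.card : ℝ) ^ m ≤
      ((m + 1).factorial : ℝ) * (∑ i ∈ s, (r i).choose (m + 1) : ℕ) := by
  have hle : X ≤ ∑ i ∈ s, ((r i - (m + 1) : ℕ) : ℝ) := by
    have : ∑ i ∈ s, (r i : ℝ) ≤ ∑ i ∈ s, (((r i - (m + 1) : ℕ) : ℝ) + (m + 1)) := by
      refine sum_le_sum fun i _ => ?_
      exact_mod_cast (by omega : r i ≤ r i - (m + 1) + (m + 1))
    rw [sum_add_distrib, sum_const, nsmul_eq_mul] at this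
    linarith
  calc X ^ (m + 1) / (s.card : ℝ) ^ m
      ≤ (∑ i ∈ s, ((r i - (m + 1) : ℕ) : ℝ)) ^ (m + 1) / (s.card : ℝ) ^ m := by gcongr
    _ ≤ ∑ i ∈ s, ((r i - (m + 1) : ℕ) : ℝ) ^ (m + 1) :=
      pow_sum_div_card_le_sum_pow (fun i _ => by positivity) m
    _ ≤ ∑ i ∈ s, ((m + 1).factorial : ℝ) * ((r i).choose (m + 1) : ℝ) := by
      refine sum_le_sum fun i _ => ?_
      exact_mod_cast sub_pow_le_factorial_mul_choose (r i) (m + 1)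
    _ = _ := by rw [← mul_sum]; push_cast; rfl

/-- For every even `ℓ ≥ 2`, every set of `n ≥ 2` reals satisfies
`|A - A| = Ω(n^{4/3})` or `E^D_ℓ(A) = Ω(n^{4ℓ}/|A-A|^{3ℓ-2})`. -/
theorem dumbbell_energy_dichotomy (ℓ : ℕ) (hℓe : Even ℓ) (hℓ : 2 ≤ ℓ) :
    ∃ c₁ c₂ : ℝ, 0 < c₁ ∧ 0 < c₂ ∧
      ∀ (n : ℕ) (A : Finset ℝ), A.card = n → 2 ≤ n →
        c₁ * (n : ℝ) ^ ((4 : ℝ) / 3) ≤ (diffSet A).card ∨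
        c₂ * (n : ℝ) ^ (4 * ℓ) / ((diffSet A).card : ℝ) ^ (3 * ℓ - 2) ≤ ED A ℓ := by
  obtain ⟨m, rfl⟩ : ∃ m, ℓ = m + 1 := ⟨ℓ - 1, by omega⟩
  refine ⟨1 / (256 * (m + 1)), 1 / (256 ^ (m + 1) * (m + 1).factorial), by positivity,
    by positivity, ?_⟩
  rintro n A rfl hn
  refine or_iff_not_imp_left.2 fun hlt => ?_
  rw [not_le] at hlt
  have hmain := card_pow_four_le A hn
  have hDpos : 0 < (diffSet A).card := by
    obtain ⟨a, ha, b, hb, hab⟩ := one_lt_card.1 hn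
    rcases lt_or_gt_of_ne hab with h | h
    · exact card_pos.2 ⟨_, sub_mem_diffSet ha hb h⟩
    · exact card_pos.2 ⟨_, sub_mem_diffSet hb ha h⟩
  have hpow := pow_le_mul_sum_choose (diffSet A ×ˢ diffSet A) (fun p => rD A p.1 p.2) m
    (X := (A.card : ℝ) ^ 4 / (256 * (diffSet A).card)) (by positivity)
  rw [← Nat.cast_sum, ← card_dumbbells, card_product] at hpow
  rw [ED]
  generalize (∑ p ∈ diffSet A ×ˢ diffSet A, (rD A p.1 p.2).choose (m + 1)) = E at *
  generalize (dumbbells A).card = T at *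
  generalize (diffSet A).card = D at *
  generalize A.card = N at *
  have hmain' : (N : ℝ) ^ 4 ≤ 16 * D * (4 * T + 3 * N ^ 2) := by exact_mod_cast hmain
  have hD : (0 : ℝ) < D := by exact_mod_cast hDpos
  have hN : (2 : ℝ) ≤ N := by exact_mod_cast hn
  have hm : (1 : ℝ) ≤ m + 1 := by linarith [(Nat.cast_nonneg m : (0 : ℝ) ≤ m)]
  have hlt' : 256 * (m + 1) * (D : ℝ) < (N : ℝ) ^ ((4 : ℝ) / 3) := by
    rw [one_div_mul_eq_div, lt_div_iff₀ (by positivity)] at hlt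
    linarith
  have hsq : 256 * (D : ℝ) ≤ (N : ℝ) ^ 2 := by
    have h : (N : ℝ) ^ ((4 : ℝ) / 3) ≤ (N : ℝ) ^ 2 := by
      rw [← Real.rpow_natCast]
      exact Real.rpow_le_rpow_of_exponent_le (by linarith) (by norm_num)
    nlinarith
  have hcube : 256 * (m + 1) * (D : ℝ) ^ 3 ≤ (N : ℝ) ^ 4 := by
    have h : ((N : ℝ) ^ ((4 : ℝ) / 3)) ^ 3 = (N : ℝ) ^ 4 := by
      rw [← Real.rpow_natCast, ← Real.rpow_mul (by positivity), ← Real.rpow_natCast]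
      norm_num
    calc 256 * (m + 1) * (D : ℝ) ^ 3 ≤ (256 * (m + 1)) ^ 3 * (D : ℝ) ^ 3 := by
          gcongr
          exact le_self_pow₀ (by linarith) (by norm_num)
      _ = (256 * (m + 1) * (D : ℝ)) ^ 3 := by ring
      _ ≤ ((N : ℝ) ^ ((4 : ℝ) / 3)) ^ 3 := by gcongr
      _ = _ := h
  have hX := hpow (by
    have h1 : (N : ℝ) ^ 4 ≤ 128 * D * T := by
      have := mul_le_mul_of_nonneg_right hsq (sq_nonneg (N : ℝ))
      nlinarith
    have h2 : (N : ℝ) ^ 4 / (256 * D) + (m + 1) * D ^ 2 ≤ T := by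
      rw [div_add' _ _ _ (by positivity), div_le_iff₀ (by positivity)]
      nlinarith
    push_cast
    linarith)
  have he : 3 * (m + 1) - 2 = (m + 1) + 2 * m := by omega
  rw [he]
  calc 1 / (256 ^ (m + 1) * ((m + 1).factorial : ℝ)) * (N : ℝ) ^ (4 * (m + 1)) /
        (D : ℝ) ^ (m + 1 + 2 * m)
      = ((N : ℝ) ^ 4 / (256 * D)) ^ (m + 1) / ((D * D : ℕ) : ℝ) ^ m / (m + 1).factorial := by
        rw [Nat.cast_mul, ← sq, ← pow_mul, pow_add (D : ℝ), div_pow, mul_pow, pow_mul (N : ℝ)]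
        field_simp
    _ ≤ E := by
        rw [div_le_iff₀ (by positivity), mul_comm (E : ℝ)]
        exact hX
end

section
/- Let k be a positive integer divisible by 4, and let A' ⊆ ℝ be a set of k distinct real numbers that is the union of the element sets of k/4 pairwise disjoint dumbbells, all congruent to one another. Then |A' − A'| ≤ 9k²/32 − 9k/8 + 4. -/
open Finset Pointwise

/-- `(a₁,a₂,a₃,a₄)` forms a dumbbell if `a₁ < a₂ < a₃ < a₄` and `a₂ − a₁ = a₄ − a₃`. -/
def IsDumbbell (q : ℝ × ℝ × ℝ × ℝ) : Prop :=
  q.1 < q.2.1 ∧ q.2.1 < q.2.2.1 ∧ q.2.2.1 < q.2.2.2 ∧ q.2.1 - q.1 = q.2.2.2 - q.2.2.1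

/-- The translate of a quadruple by `t`. -/
def translateQ (q : ℝ × ℝ × ℝ × ℝ) (t : ℝ) : ℝ × ℝ × ℝ × ℝ :=
  (q.1 + t, q.2.1 + t, q.2.2.1 + t, q.2.2.2 + t)

/-- Two quadruples are congruent if one is a translate of the other. -/
def CongruentQ (q q' : ℝ × ℝ × ℝ × ℝ) : Prop := ∃ t : ℝ, q' = translateQ q t

/-- The element set of a quadruple. -/
noncomputable def elemsQ (q : ℝ × ℝ × ℝ × ℝ) : Finset ℝ :=
  {q.1, q.2.1, q.2.2.1, q.2.2.2}

/-- For nonempty `A`, the set `A - A` contains `0` and is symmetric about it. -/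
lemma two_mul_card_diffSet_add_one_le {A : Finset ℝ} (hA : A.Nonempty) :
    2 * #(diffSet A) + 1 ≤ #(A - A) := by
  have hneg : -diffSet A ⊆ A - A := by
    rw [← neg_sub A A]
    exact Finset.neg_subset_neg (filter_subset _ _)
  have hdisj : Disjoint (diffSet A) (-diffSet A) := by
    refine Finset.disjoint_left.2 fun x hx hx' => ?_
    have h₁ := (mem_filter.1 hx).2
    have h₂ := (mem_filter.1 (Finset.mem_neg'.1 hx')).2
    linarith
  have hzero : (0 : ℝ) ∉ diffSet A ∪ -diffSet A := by simp [diffSet]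
  have hsub : insert 0 (diffSet A ∪ -diffSet A) ⊆ A - A := by
    refine insert_subset ?_ (union_subset (filter_subset _ _) hneg)
    obtain ⟨a, ha⟩ := hA
    exact Finset.mem_sub.2 ⟨a, ha, a, ha, sub_self a⟩
  have h := card_le_card hsub
  rw [card_insert_of_notMem hzero, card_union_of_disjoint hdisj, Finset.card_neg] at h
  omega

lemma card_sub_self_le (T : Finset ℝ) : #(T - T) ≤ #T * (#T - 1) + 1 := by
  have hsub : T - T ⊆ insert 0 (T.offDiag.image fun p => p.1 - p.2) := by
    intro x hx
    obtain ⟨a, ha, b, hb, rfl⟩ := Finset.mem_sub.1 hx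
    rcases eq_or_ne a b with rfl | hab
    · simp
    · exact mem_insert_of_mem (mem_image.2 ⟨(a, b), mem_offDiag.2 ⟨ha, hb, hab⟩, rfl⟩)
  calc #(T - T) ≤ #(T.offDiag.image fun p => p.1 - p.2) + 1 :=
        (card_le_card hsub).trans (card_insert_le _ _)
    _ ≤ #T.offDiag + 1 := by gcongr; exact card_image_le
    _ = #T * (#T - 1) + 1 := by rw [offDiag_card, Nat.mul_sub_one]

lemma elemsQ_translateQ (q : ℝ × ℝ × ℝ × ℝ) (t : ℝ) :
    elemsQ (translateQ q t) = {t} + elemsQ q := by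
  ext x
  simp [elemsQ, translateQ, Finset.mem_add, add_comm, eq_comm]

/-- The elements of a dumbbell form a translate of `{0, a} + {0, b}`. -/
lemma IsDumbbell.card_elemsQ_sub_le {q : ℝ × ℝ × ℝ × ℝ} (hq : IsDumbbell q) :
    #(elemsQ q - elemsQ q) ≤ 9 := by
  obtain ⟨-, -, -, h⟩ := hq
  set a := q.2.1 - q.1 with ha
  set b := q.2.2.1 - q.1 with hb
  have hfac : elemsQ q ⊆ {q.1} + (({0, a} : Finset ℝ) + {0, b}) := by
    intro x hx
    simp only [elemsQ, mem_insert, mem_singleton] at hx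
    simp only [Finset.mem_add, mem_insert, mem_singleton, exists_eq_left, exists_eq_or_imp,
      zero_add, add_zero]
    rcases hx with rfl | rfl | rfl | rfl
    · exact ⟨0, by simp⟩
    · exact ⟨a, by simp, by linarith⟩
    · exact ⟨b, by simp, by linarith⟩
    · exact ⟨a + b, by simp, by linarith⟩
  have hpair (c : ℝ) : #(({0, c} : Finset ℝ) - {0, c}) ≤ 3 :=
    (card_sub_self_le _).trans <| by
      have := card_le_two (a := (0 : ℝ)) (b := c)
      interval_cases #({0, c} : Finset ℝ) <;> norm_num
  calc #(elemsQ q - elemsQ q)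
      ≤ #(({q.1} + (({0, a} : Finset ℝ) + {0, b})) - ({q.1} + (({0, a} : Finset ℝ) + {0, b}))) :=
        card_le_card (Finset.sub_subset_sub hfac hfac)
    _ = #((({0, a} : Finset ℝ) - {0, a}) + (({0, b} : Finset ℝ) - {0, b})) := by
        rw [add_sub_add_comm, add_sub_add_comm, Finset.singleton_sub_singleton, sub_self,
          Finset.singleton_zero, zero_add]
    _ ≤ 3 * 3 := card_add_le.trans (Nat.mul_le_mul (hpair a) (hpair b))
    _ = 9 := rfl

/-- If `A'` is a set of `k` reals (with `4 ∣ k`) that is the union of the element sets of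
`k/4` pairwise disjoint, pairwise congruent dumbbells, then
`|A' − A'| ≤ 9k²/32 − 9k/8 + 4`. -/
theorem diffSet_of_congruent_dumbbells (k : ℕ) (hk4 : 4 ∣ k) (hk : 0 < k)
    (A' : Finset ℝ) (f : Fin (k / 4) → ℝ × ℝ × ℝ × ℝ)
    (hdumb : ∀ i, IsDumbbell (f i))
    (hcong : ∀ i j, CongruentQ (f i) (f j))
    (hdisj : ∀ i j, i ≠ j → Disjoint (elemsQ (f i)) (elemsQ (f j)))
    (hA : A' = Finset.univ.biUnion fun i => elemsQ (f i))
    (hcard : A'.card = k) :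
    ((diffSet A').card : ℝ) ≤ 9 * k ^ 2 / 32 - 9 * k / 8 + 4 := by
  obtain ⟨n, rfl⟩ := hk4
  have hdiv : 4 * n / 4 = n := by omega
  have hn : 0 < 4 * n / 4 := by omega
  let o : Fin (4 * n / 4) := ⟨0, hn⟩
  choose t ht using fun i => hcong o i
  have hfac : A' = univ.image t + elemsQ (f o) := by
    subst hA
    ext x
    simp only [mem_biUnion, mem_univ, true_and, Finset.mem_add, mem_image,
      exists_exists_eq_and]
    refine exists_congr fun i => ?_
    rw [ht i, elemsQ_translateQ]
    simp [Finset.mem_add]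
  have hT : #(univ.image t) ≤ n := card_image_le.trans (by simp [hdiv])
  have hne : A'.Nonempty := card_pos.1 (by omega)
  have hmain : 2 * #(diffSet A') + 1 ≤ (n * (n - 1) + 1) * 9 := by
    refine (two_mul_card_diffSet_add_one_le hne).trans ?_
    rw [hfac, add_sub_add_comm]
    refine card_add_le.trans (Nat.mul_le_mul ((card_sub_self_le _).trans ?_)
      (hdumb o).card_elemsQ_sub_le)
    gcongr
  obtain ⟨m, rfl⟩ : ∃ m, n = m + 1 := ⟨n - 1, by omega⟩
  have hreal : (2 * #(diffSet A') + 1 : ℝ) ≤ ((m + 1) * m + 1) * 9 := by exact_mod_cast hmain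
  push_cast
  linarith
end

section
/- Let k ≥ 4 be an even integer, let d > 0 be a real number, and let a₁ > a₂ > ... > a_{k/2} be real numbers. Set bᵢ = aᵢ − d for each i, and suppose the k numbers a₁,...,a_{k/2}, b₁,...,b_{k/2} are pairwise distinct. Then the set S = {a₁,...,a_{k/2}} ∪ {b₁,...,b_{k/2}} satisfies |S − S| ≤ 3k²/8 − 3k/4 + 1. -/
open Finset Pointwise

/-- Twice the number of pairs `i < j` in `Fin m` is `m * (m - 1)`. -/
lemma card_sigma_Iio_mul_two (m : ℕ) :
    ((Finset.univ : Finset (Fin m)).sigma fun j => Finset.Iio j).card * 2 = m * (m - 1) := by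
  rw [Finset.card_sigma, ← Finset.sum_range_id_mul_two, ← Fin.sum_univ_eq_sum_range]
  simp

/-- Every positive difference of `A ∪ (A - d)` is `d`, or one of `x`, `x + d`, `|x - d|` for some
positive difference `x` of `A`. -/
lemma diffSet_union_sub_subset {m : ℕ} {d : ℝ} (hd : 0 < d) (a : Fin m → ℝ) (ha : StrictAnti a) :
    diffSet (Finset.image a Finset.univ ∪ Finset.image (fun i => a i - d) Finset.univ) ⊆
      let P := (Finset.univ : Finset (Fin m)).sigma fun j => Finset.Iio j
      insert d (P.image (fun p => a p.2 - a p.1) ∪ P.image (fun p => a p.2 - a p.1 + d) ∪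
        P.image (fun p => |a p.2 - a p.1 - d|)) := by
  intro x hx
  simp only [diffSet, Finset.mem_filter, Finset.mem_sub, Finset.mem_union, Finset.mem_image,
    Finset.mem_univ, true_and] at hx
  obtain ⟨⟨s, hs, t, ht, rfl⟩, hpos⟩ := hx
  simp only [Finset.mem_insert, Finset.mem_union, Finset.mem_image, Finset.mem_sigma,
    Finset.mem_univ, true_and, Finset.mem_Iio, Sigma.exists]
  rcases hs with ⟨i, rfl⟩ | ⟨i, rfl⟩ <;> rcases ht with ⟨j, rfl⟩ | ⟨j, rfl⟩
  · exact .inr (.inl (.inl ⟨j, i, ha.lt_iff_gt.1 (by linarith), rfl⟩))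
  · rcases lt_trichotomy i j with h | rfl | h
    · exact .inr (.inl (.inr ⟨j, i, h, by ring⟩))
    · left; ring
    · refine .inr (.inr ⟨i, j, h, ?_⟩)
      rw [abs_of_neg] <;> linarith
  · rcases lt_trichotomy i j with h | rfl | h
    · refine .inr (.inr ⟨j, i, h, ?_⟩)
      rw [abs_of_pos] <;> linarith
    · linarith
    · linarith [ha h]
  · exact .inr (.inl (.inl ⟨j, i, ha.lt_iff_gt.1 (by linarith), by ring⟩))

/-- If `a₁ > a₂ > ⋯ > a_{k/2}`, `bᵢ = aᵢ − d` with `d > 0`, and the `k` numbers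
`a₁,…,a_{k/2},b₁,…,b_{k/2}` are pairwise distinct, then their union `S` satisfies
`|S − S| ≤ 3k²/8 − 3k/4 + 1`. -/
theorem diffSet_of_repeated_difference (k : ℕ) (hk : 4 ≤ k) (hke : Even k)
    (d : ℝ) (hd : 0 < d) (a : Fin (k / 2) → ℝ)
    (ha : ∀ i j : Fin (k / 2), i < j → a j < a i)
    (S : Finset ℝ)
    (hS : S = Finset.image a Finset.univ ∪
      Finset.image (fun i => a i - d) Finset.univ)
    (hcard : S.card = k) :
    ((diffSet S).card : ℝ) ≤ 3 * k ^ 2 / 8 - 3 * k / 4 + 1 := by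
  subst hS
  obtain ⟨m, rfl⟩ := hke.two_dvd
  have hm : 2 * m / 2 = m := by omega
  have hP := (card_sigma_Iio_mul_two (2 * m / 2)).trans (show _ = m * (m - 1) by rw [hm])
  have hsub := Finset.card_le_card (diffSet_union_sub_subset hd a fun i j hij => ha i j hij)
  set P := (Finset.univ : Finset (Fin (2 * m / 2))).sigma fun j => Finset.Iio j
  have hle := hsub.trans <| (Finset.card_insert_le _ _).trans <| Nat.add_le_add_right
    ((Finset.card_union_le _ _).trans <| Nat.add_le_add
      ((Finset.card_union_le _ _).trans <| Nat.add_le_add Finset.card_image_le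
        Finset.card_image_le) Finset.card_image_le) 1
  have hP' : (P.card : ℝ) * 2 = m * (m - 1) := by
    rw [← Nat.cast_pred (by omega)]
    exact_mod_cast hP
  have hle' : ((diffSet (Finset.image a Finset.univ ∪
      Finset.image (fun i => a i - d) Finset.univ)).card : ℝ) ≤
      P.card + P.card + P.card + 1 := by exact_mod_cast hle
  push_cast
  linarith
end

section
/- For all integers 0 ≤ j < m, setting k = 2^j and n = 2^m, there exists a set A of n distinct real numbers satisfying the (k, (3^j − 1)/2)-local property with |A − A| ≤ (3^m − 1)/2. (Since k^{log₂3} = 3^j and n^{log₂3} = 3^m, this says g(n, k, (k^{log₂3} − 1)/2) = O(n^{log₂3}) for n, k powers of two.) -/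
open Finset Pointwise

theorem convexOn_one_sub_add_rpow_sub_rpow {α : ℝ} (h1 : 1 / 2 ≤ α) (h2 : α < 1) :
    ConvexOn ℝ (Set.Icc 0 1) (fun u : ℝ => 1 - u + 2 * u ^ α - 2 * u ^ (1 - α)) := by
  have hd : ∀ u : ℝ, 0 < u → HasDerivAt (fun u : ℝ => 1 - u + 2 * u ^ α - 2 * u ^ (1 - α))
      (-1 + 2 * (α * u ^ (α - 1)) - 2 * ((1 - α) * u ^ (-α))) u := by
    intro u hu
    have e1 := Real.hasDerivAt_rpow_const (x := u) (p := α) (Or.inl hu.ne')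
    have e2 := Real.hasDerivAt_rpow_const (x := u) (p := 1 - α) (Or.inl hu.ne')
    rw [show 1 - α - 1 = -α by ring] at e2
    exact (((hasDerivAt_id u).const_sub 1).add (e1.const_mul 2)).sub (e2.const_mul 2)
  have hd2 : ∀ u : ℝ, 0 < u → HasDerivAt
      (fun u : ℝ => -1 + 2 * (α * u ^ (α - 1)) - 2 * ((1 - α) * u ^ (-α)))
      (2 * (α * ((α - 1) * u ^ (α - 2))) - 2 * ((1 - α) * ((-α) * u ^ (-α - 1)))) u := by
    intro u hu
    have e1 := Real.hasDerivAt_rpow_const (x := u) (p := α - 1) (Or.inl hu.ne')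
    have e2 := Real.hasDerivAt_rpow_const (x := u) (p := -α) (Or.inl hu.ne')
    rw [show α - 1 - 1 = α - 2 by ring] at e1
    exact (((e1.const_mul α).const_mul 2).const_add (-1)).sub ((e2.const_mul (1 - α)).const_mul 2)
  refine convexOn_of_hasDerivWithinAt2_nonneg (convex_Icc 0 1)
    (f' := fun u => -1 + 2 * (α * u ^ (α - 1)) - 2 * ((1 - α) * u ^ (-α)))
    (f'' := fun u => 2 * (α * ((α - 1) * u ^ (α - 2))) - 2 * ((1 - α) * ((-α) * u ^ (-α - 1))))
    ?_ ?_ ?_ ?_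
  · have := Real.continuous_rpow_const (q := α) (by linarith)
    have := Real.continuous_rpow_const (q := 1 - α) (by linarith)
    fun_prop
  · intro u hu
    rw [interior_Icc] at hu
    exact (hd u hu.1).hasDerivWithinAt
  · intro u hu
    rw [interior_Icc] at hu
    exact (hd2 u hu.1).hasDerivWithinAt
  · intro u hu
    rw [interior_Icc] at hu
    have := Real.rpow_le_rpow_of_exponent_ge hu.1 hu.2.le (show -α - 1 ≤ α - 2 by linarith)
    have h3 : 0 ≤ α * (1 - α) := mul_nonneg (by linarith) (by linarith)
    show 0 ≤ 2 * (α * ((α - 1) * u ^ (α - 2))) - 2 * ((1 - α) * ((-α) * u ^ (-α - 1)))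
    nlinarith [mul_nonneg h3 (sub_nonneg.2 this)]

theorem one_add_rpow_two_mul_le {α : ℝ} (h1 : 1 / 2 ≤ α) (h2 : α < 1) (h4 : (4 : ℝ) ^ α = 3)
    {v : ℝ} (hv0 : 0 ≤ v) (hv1 : v ≤ 1) : (1 + v) ^ (2 * α) ≤ 1 + v ^ α + v ^ (2 * α) := by
  set L : ℝ → ℝ := fun u => Real.log (1 + u ^ α + u ^ (2 * α)) - 2 * α * Real.log (1 + u) with hL
  have hpos : ∀ u : ℝ, 0 ≤ u → 0 < 1 + u ^ α + u ^ (2 * α) := fun u hu => by positivity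
  have hcont : ContinuousOn L (Set.Ici 0) := by
    have := Real.continuous_rpow_const (q := α) (by linarith)
    have := Real.continuous_rpow_const (q := 2 * α) (by linarith)
    refine ContinuousOn.sub (ContinuousOn.log (by fun_prop) fun u hu => (hpos u hu).ne')
      (ContinuousOn.mul (by fun_prop) (ContinuousOn.log (by fun_prop) fun u hu => ?_))
    have : (0 : ℝ) ≤ u := hu
    positivity
  have hd : ∀ u : ℝ, 0 < u → HasDerivAt L
      (α * u ^ (α - 1) * (1 - u + 2 * u ^ α - 2 * u ^ (1 - α)) /
        ((1 + u ^ α + u ^ (2 * α)) * (1 + u))) u := by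
    intro u hu
    have e1 := Real.hasDerivAt_rpow_const (x := u) (p := α) (Or.inl hu.ne')
    have e2 := Real.hasDerivAt_rpow_const (x := u) (p := 2 * α) (Or.inl hu.ne')
    have e3 := (((e1.const_add 1).add e2).log (hpos u hu.le).ne').sub
      ((((hasDerivAt_id u).const_add 1).log (by simp only [id]; positivity)).const_mul (2 * α))
    refine e3.congr_deriv (Eq.symm ?_)
    have hp := hpos u hu.le
    have q1 : u ^ (2 * α) = u ^ α * u ^ α := by rw [← Real.rpow_add hu]; ring_nf
    have q2 : u ^ (2 * α - 1) = u ^ α * u ^ α / u := by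
      rw [Real.rpow_sub_one hu.ne', q1]
    have q3 : u ^ (1 - α) = u / u ^ α := by rw [Real.rpow_sub hu, Real.rpow_one]
    have q4 : u ^ (α - 1) = u ^ α / u := Real.rpow_sub_one hu.ne' _
    have q5 : 0 < u ^ α := by positivity
    rw [q1] at hp
    simp only [id, Pi.add_apply]
    rw [q2, q3, q4, q1]
    field_simp
    ring
  have hL0 : L 0 = 0 := by
    simp [hL, Real.zero_rpow (show α ≠ 0 by linarith),
      Real.zero_rpow (show 2 * α ≠ 0 by linarith)]
  have hL1 : L 1 = 0 := by
    have : Real.log 3 = α * Real.log 4 := by rw [← h4, Real.log_rpow (by norm_num)]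
    have h42 : Real.log 4 = 2 * Real.log 2 := by
      rw [show (4 : ℝ) = 2 ^ 2 by norm_num, Real.log_pow]; norm_num
    simp only [hL, Real.one_rpow]
    norm_num
    rw [this, h42]; ring
  have hconv := convexOn_one_sub_add_rpow_sub_rpow h1 h2
  set ψ : ℝ → ℝ := fun u => 1 - u + 2 * u ^ α - 2 * u ^ (1 - α) with hψ
  have hψ1 : ψ 1 = 0 := by simp [hψ]
  have key : ∀ a b : ℝ, 0 ≤ a → a ≤ b → b < 1 → ψ a ≤ 0 → ψ b ≤ 0 := by
    intro a b ha hab hb hψa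
    have : b ∈ segment ℝ a 1 := by
      rw [segment_eq_Icc (by linarith)]; exact ⟨hab, hb.le⟩
    have h := hconv.le_on_segment ⟨ha, by linarith⟩ ⟨zero_le_one, le_rfl⟩ this
    rw [hψ1, max_eq_right hψa] at h
    exact h
  have hfin : 0 ≤ L v := by
    rcases eq_or_lt_of_le hv1 with rfl | hv1'
    · exact hL1.ge
    rcases le_total (ψ v) 0 with hψv | hψv
    · have : AntitoneOn L (Set.Icc v 1) := by
        refine antitoneOn_of_hasDerivWithinAt_nonpos (convex_Icc v 1)
          (hcont.mono fun u hu => hv0.trans hu.1)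
          (fun u hu => (hd u ?_).hasDerivWithinAt) ?_
        · rw [interior_Icc] at hu; exact hv0.trans_lt hu.1
        · intro u hu
          rw [interior_Icc] at hu
          have hu0 : 0 < u := hv0.trans_lt hu.1
          have := hpos u hu0.le
          exact div_nonpos_of_nonpos_of_nonneg (mul_nonpos_of_nonneg_of_nonpos
            (mul_nonneg (by linarith) (by positivity)) (key v u hv0 hu.1.le hu.2 hψv))
            (by positivity)
      have h := this ⟨le_rfl, hv1⟩ ⟨hv1, le_rfl⟩ hv1
      rwa [hL1] at h
    · have : MonotoneOn L (Set.Icc 0 v) := by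
        refine monotoneOn_of_hasDerivWithinAt_nonneg (convex_Icc 0 v)
          (hcont.mono fun u hu => hu.1)
          (fun u hu => (hd u ?_).hasDerivWithinAt) ?_
        · rw [interior_Icc] at hu; exact hu.1
        · intro u hu
          rw [interior_Icc] at hu
          have hu0 : 0 < u := hu.1
          have := hpos u hu0.le
          have hψu : 0 ≤ ψ u := by
            by_contra! hneg
            have hseg : v ∈ openSegment ℝ u 1 := by
              rw [openSegment_eq_Ioo (hu.2.trans hv1')]; exact ⟨hu.2, hv1'⟩
            obtain ⟨s, t, hs, ht, hst, rfl⟩ := hseg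
            have h := hconv.2 ⟨hu0.le, (hu.2.trans hv1').le⟩ ⟨zero_le_one, le_rfl⟩ hs.le ht.le hst
            simp only [smul_eq_mul, hψ1, mul_zero, add_zero] at h hψv
            nlinarith
          exact div_nonneg (mul_nonneg
            (mul_nonneg (by linarith) (by positivity)) hψu) (by positivity)
      have h := this ⟨le_rfl, hv0⟩ ⟨hv0, le_rfl⟩ hv0
      rwa [hL0] at h
  have hv : 0 < 1 + v := by linarith
  rw [← Real.log_le_log_iff (by positivity) (hpos v hv0), Real.log_rpow hv]
  linarith

theorem mul_one_add_rpow_le {α : ℝ} (h1 : 1 / 2 ≤ α) (h2 : α < 1) (h4 : (4 : ℝ) ^ α = 3)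
    {x y : ℝ} (hx : 0 ≤ x) (hy : 0 ≤ y) (hxy : x * y ≤ 1) :
    ((1 + x) * (1 + y)) ^ α ≤ 1 + x ^ α + y ^ α := by
  wlog hle : x ≤ y generalizing x y
  · have := this hy hx (by linarith) (le_of_not_ge hle)
    rw [mul_comm]; linarith
  have hsub : ∀ z : ℝ, 0 ≤ z → (1 + z) ^ α ≤ 1 + z ^ α := fun z hz => by
    simpa using Real.rpow_add_le_add_rpow zero_le_one hz (by linarith) h2.le
  rcases eq_or_lt_of_le hx with rfl | hx0
  · have := hsub y hy
    simp only [add_zero, one_mul, Real.zero_rpow (show α ≠ 0 by linarith)]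
    exact this
  have hx1 : x ≤ 1 := by nlinarith
  have hy0 : 0 < y := by linarith
  set h : ℝ → ℝ := fun z => 1 + x ^ α + z ^ α - (1 + x) ^ α * (1 + z) ^ α with hh
  have hcont : ContinuousOn h (Set.Ici 0) := by
    have := Real.continuous_rpow_const (q := α) (by linarith)
    have h3 : Continuous fun z : ℝ => (1 + z) ^ α := this.comp (continuous_const.add continuous_id)
    fun_prop
  have hd : ∀ z : ℝ, 0 < z → HasDerivAt h
      (α * (z ^ (α - 1) - (1 + x) ^ α * (1 + z) ^ (α - 1))) z := by
    intro z hz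
    have e1 := Real.hasDerivAt_rpow_const (x := z) (p := α) (Or.inl hz.ne')
    have e2 := ((hasDerivAt_id z).const_add 1).rpow_const (p := α)
      (Or.inl (by simp only [id]; positivity))
    refine ((e1.const_add (1 + x ^ α)).sub (e2.const_mul ((1 + x) ^ α))).congr_deriv ?_
    simp only [id]
    ring
  have hsign : ∀ a b : ℝ, 0 < a → a ≤ b → (1 + x) ^ α ≤ ((1 + b) / b) ^ (1 - α) →
      (1 + x) ^ α ≤ ((1 + a) / a) ^ (1 - α) := by
    intro a b ha hab hb
    have hb0 : 0 < b := by linarith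
    refine hb.trans (Real.rpow_le_rpow (by positivity) ?_ (by linarith))
    rw [div_le_div_iff₀ hb0 ha]; nlinarith
  have hrw : ∀ z : ℝ, 0 < z → z ^ (α - 1) - (1 + x) ^ α * (1 + z) ^ (α - 1) =
      (1 + z) ^ (α - 1) * (((1 + z) / z) ^ (1 - α) - (1 + x) ^ α) := by
    intro z hz
    have hz1 : 0 < 1 + z := by linarith
    rw [Real.div_rpow hz1.le hz.le, show α - 1 = -(1 - α) by ring, Real.rpow_neg hz.le,
      Real.rpow_neg hz1.le]
    have : 0 < z ^ (1 - α) := by positivity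
    have : 0 < (1 + z) ^ (1 - α) := by positivity
    field_simp
  have hh0 : 0 ≤ h 0 := by
    have := hsub x hx
    simp only [hh, Real.zero_rpow (show α ≠ 0 by linarith), add_zero, Real.one_rpow, mul_one]
    linarith
  have hhinv : 0 ≤ h (1 / x) := by
    have := one_add_rpow_two_mul_le h1 h2 h4 hx hx1
    have hx1' : 0 < 1 + x := by linarith
    have q1 : x ^ (2 * α) = x ^ α * x ^ α := by rw [← Real.rpow_add hx0]; ring_nf
    have q2 : (1 + x) ^ (2 * α) = (1 + x) ^ α * (1 + x) ^ α := by
      rw [← Real.rpow_add hx1']; ring_nf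
    have q3 : 0 < x ^ α := by positivity
    have : h (1 / x) = (1 + x ^ α + x ^ (2 * α) - (1 + x) ^ (2 * α)) / x ^ α := by
      simp only [hh]
      rw [show 1 + 1 / x = (1 + x) / x by field_simp; ring, Real.div_rpow zero_le_one hx,
        Real.div_rpow hx1'.le hx, Real.one_rpow, q1, q2]
      field_simp
      ring
    rw [this]
    exact div_nonneg (by linarith) q3.le
  have hyx : y ≤ 1 / x := by rw [le_div_iff₀ hx0]; linarith
  have hfin : 0 ≤ h y := by
    rcases le_total ((1 + x) ^ α) (((1 + y) / y) ^ (1 - α)) with hs | hs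
    · have : MonotoneOn h (Set.Icc 0 y) := by
        refine monotoneOn_of_hasDerivWithinAt_nonneg (convex_Icc 0 y)
          (hcont.mono fun u hu => hu.1)
          (fun u hu => (hd u ?_).hasDerivWithinAt) ?_
        · rw [interior_Icc] at hu; exact hu.1
        · intro u hu
          rw [interior_Icc] at hu
          have hu0 : 0 < u := hu.1
          rw [hrw u hu0]
          exact mul_nonneg (by linarith) (mul_nonneg (by positivity)
            (sub_nonneg.2 (hsign u y hu0 hu.2.le hs)))
      exact hh0.trans (this ⟨le_rfl, hy⟩ ⟨hy, le_rfl⟩ hy)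
    · have : AntitoneOn h (Set.Icc y (1 / x)) := by
        refine antitoneOn_of_hasDerivWithinAt_nonpos (convex_Icc y (1 / x))
          (hcont.mono fun u hu => hy.trans hu.1)
          (fun u hu => (hd u ?_).hasDerivWithinAt) ?_
        · rw [interior_Icc] at hu; exact hy.trans_lt hu.1
        · intro u hu
          rw [interior_Icc] at hu
          have hu0 : 0 < u := hy.trans_lt hu.1
          rw [hrw u hu0]
          refine mul_nonpos_of_nonneg_of_nonpos (by linarith) (mul_nonpos_of_nonneg_of_nonpos
            (by positivity) (sub_nonpos.2 (le_trans ?_ hs)))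
          refine Real.rpow_le_rpow (by positivity) ?_ (by linarith)
          rw [div_le_div_iff₀ hu0 hy0]; nlinarith [hu.1]
      exact hhinv.trans (this ⟨le_rfl, hyx⟩ ⟨hyx, le_rfl⟩ hyx)
  rw [Real.mul_rpow (by linarith) (by linarith)]
  simp only [hh] at hfin
  linarith

theorem add_mul_add_rpow_le {α : ℝ} (h1 : 1 / 2 ≤ α) (h2 : α < 1) (h4 : (4 : ℝ) ^ α = 3)
    {a₀ a₁ b₀ b₁ : ℝ} (ha₀ : 0 ≤ a₀) (ha₁ : 0 ≤ a₁) (hb₀ : 0 ≤ b₀) (hb₁ : 0 ≤ b₁)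
    (hab : a₁ * b₁ ≤ a₀ * b₀) :
    ((a₀ + a₁) * (b₀ + b₁)) ^ α ≤ (a₀ * b₀) ^ α + (a₀ * b₁) ^ α + (a₁ * b₀) ^ α := by
  have hα : α ≠ 0 := by linarith
  rcases eq_or_lt_of_le ha₀ with rfl | ha
  · have : a₁ * b₁ = 0 := le_antisymm (by linarith) (by positivity)
    simp [mul_add, this, Real.zero_rpow hα]
  rcases eq_or_lt_of_le hb₀ with rfl | hb
  · have : a₁ * b₁ = 0 := le_antisymm (by linarith) (by positivity)
    simp [add_mul, this, Real.zero_rpow hα]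
  have hx : 0 ≤ a₁ / a₀ := by positivity
  have hy : 0 ≤ b₁ / b₀ := by positivity
  have key := mul_one_add_rpow_le h1 h2 h4 hx hy
    (by rw [div_mul_div_comm, div_le_one (by positivity)]; exact hab)
  have := mul_le_mul_of_nonneg_left key (show 0 ≤ (a₀ * b₀) ^ α by positivity)
  rw [← Real.mul_rpow (by positivity) (by positivity), mul_add (_ ^ α), mul_add (_ ^ α) 1,
    mul_one, ← Real.mul_rpow (by positivity) hx, ← Real.mul_rpow (by positivity) hy] at this
  rw [show a₀ * b₀ * ((1 + a₁ / a₀) * (1 + b₁ / b₀)) = (a₀ + a₁) * (b₀ + b₁) by field_simp,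
    show a₀ * b₀ * (a₁ / a₀) = a₁ * b₀ by field_simp,
    show a₀ * b₀ * (b₁ / b₀) = a₀ * b₁ by field_simp] at this
  linarith

/-- The integers with `m` base-3 digits, all of them `0` or `1`. -/
def ternaryCube : ℕ → Finset ℤ
  | 0 => {0}
  | m + 1 => (ternaryCube m).image (fun a => 3 * a) ∪ (ternaryCube m).image (fun a => 3 * a + 1)

theorem card_image_three_mul_union (A₀ A₁ : Finset ℤ) :
    (A₀.image (fun a => 3 * a) ∪ A₁.image (fun a => 3 * a + 1)).card = A₀.card + A₁.card := by
  rw [card_union_of_disjoint, card_image_of_injective, card_image_of_injective]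
  · intro a b h
    simp only at h
    lia
  · intro a b h
    simp only at h
    lia
  · simp only [disjoint_left, mem_image]
    rintro _ ⟨a, -, rfl⟩ ⟨b, -, h⟩
    lia

theorem card_ternaryCube (m : ℕ) : (ternaryCube m).card = 2 ^ m := by
  induction m with
  | zero => rfl
  | succ m ih => rw [ternaryCube, card_image_three_mul_union, ih]; ring

theorem card_ternaryCube_sub_le (m : ℕ) : (ternaryCube m - ternaryCube m).card ≤ 3 ^ m := by
  induction m with
  | zero => simp [ternaryCube]
  | succ m ih =>
    have hsub : ternaryCube (m + 1) - ternaryCube (m + 1) ⊆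
        ((ternaryCube m - ternaryCube m) ×ˢ ({-1, 0, 1} : Finset ℤ)).image
          (fun p => 3 * p.1 + p.2) := by
      intro z hz
      obtain ⟨a, ha, b, hb, rfl⟩ := mem_sub.1 hz
      simp only [ternaryCube, mem_union, mem_image] at ha hb
      simp only [mem_image, mem_product, Prod.exists]
      rcases ha with ⟨a, ha, rfl⟩ | ⟨a, ha, rfl⟩ <;> rcases hb with ⟨b, hb, rfl⟩ | ⟨b, hb, rfl⟩
      · exact ⟨a - b, 0, ⟨sub_mem_sub ha hb, by simp⟩, by ring⟩
      · exact ⟨a - b, -1, ⟨sub_mem_sub ha hb, by simp⟩, by ring⟩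
      · exact ⟨a - b, 1, ⟨sub_mem_sub ha hb, by simp⟩, by ring⟩
      · exact ⟨a - b, 0, ⟨sub_mem_sub ha hb, by simp⟩, by ring⟩
    have h3 : ({-1, 0, 1} : Finset ℤ).card = 3 := rfl
    calc _ ≤ _ := card_le_card hsub
      _ ≤ _ := card_image_le
      _ = (ternaryCube m - ternaryCube m).card * 3 := by rw [card_product, h3]
      _ ≤ 3 ^ (m + 1) := by rw [pow_succ]; gcongr

theorem card_sub_add_card_sub_add_card_sub_le {A B A₀ A₁ B₀ B₁ D : Finset ℤ}
    (hA : A = A₀.image (fun a => 3 * a) ∪ A₁.image (fun a => 3 * a + 1))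
    (hB : B = B₀.image (fun a => 3 * a) ∪ B₁.image (fun a => 3 * a + 1))
    (hD : D = A₀ - B₀ ∨ D = A₁ - B₁) :
    D.card + (A₀ - B₁).card + (A₁ - B₀).card ≤ (A - B).card := by
  have i : ∀ c : ℤ, Function.Injective fun a : ℤ => 3 * a + c := fun c a b h => by
    simp only at h
    lia
  have hsub : (D.image (fun a => 3 * a + 0) ∪ (A₀ - B₁).image (fun a => 3 * a + -1)) ∪
      (A₁ - B₀).image (fun a => 3 * a + 1) ⊆ A - B := by
    have m0 : ∀ a ∈ A₀, 3 * a ∈ A := fun a ha => by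
      rw [hA]; exact mem_union_left _ (mem_image_of_mem _ ha)
    have m1 : ∀ a ∈ A₁, 3 * a + 1 ∈ A := fun a ha => by
      rw [hA]; exact mem_union_right _ (mem_image_of_mem _ ha)
    have n0 : ∀ a ∈ B₀, 3 * a ∈ B := fun a ha => by
      rw [hB]; exact mem_union_left _ (mem_image_of_mem _ ha)
    have n1 : ∀ a ∈ B₁, 3 * a + 1 ∈ B := fun a ha => by
      rw [hB]; exact mem_union_right _ (mem_image_of_mem _ ha)
    refine union_subset (union_subset ?_ ?_) ?_ <;> refine image_subset_iff.2 fun z hz => ?_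
    · rcases hD with rfl | rfl <;> obtain ⟨a, ha, b, hb, rfl⟩ := mem_sub.1 hz
      · exact mem_sub.2 ⟨_, m0 a ha, _, n0 b hb, by ring⟩
      · exact mem_sub.2 ⟨_, m1 a ha, _, n1 b hb, by ring⟩
    · obtain ⟨a, ha, b, hb, rfl⟩ := mem_sub.1 hz
      exact mem_sub.2 ⟨_, m0 a ha, _, n1 b hb, by ring⟩
    · obtain ⟨a, ha, b, hb, rfl⟩ := mem_sub.1 hz
      exact mem_sub.2 ⟨_, m1 a ha, _, n0 b hb, by ring⟩
  refine le_trans (le_of_eq ?_) (card_le_card hsub)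
  rw [card_union_of_disjoint, card_union_of_disjoint, card_image_of_injective _ (i 0),
    card_image_of_injective _ (i (-1)), card_image_of_injective _ (i 1)]
  · simp only [disjoint_left, mem_image]
    rintro _ ⟨a, -, rfl⟩ ⟨b, -, h⟩
    lia
  · simp only [disjoint_left, mem_image, mem_union]
    rintro _ (⟨a, -, rfl⟩ | ⟨a, -, rfl⟩) ⟨b, -, h⟩ <;> lia

theorem exists_eq_image_union_of_subset_ternaryCube {m : ℕ} {A : Finset ℤ}
    (hA : A ⊆ ternaryCube (m + 1)) :
    ∃ A₀ ⊆ ternaryCube m, ∃ A₁ ⊆ ternaryCube m,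
      A = A₀.image (fun a => 3 * a) ∪ A₁.image (fun a => 3 * a + 1) := by
  refine ⟨(ternaryCube m).filter (fun a => 3 * a ∈ A), filter_subset _ _,
    (ternaryCube m).filter (fun a => 3 * a + 1 ∈ A), filter_subset _ _, ?_⟩
  ext z
  simp only [mem_union, mem_image, mem_filter]
  constructor
  · intro hz
    have := hA hz
    simp only [ternaryCube, mem_union, mem_image] at this
    rcases this with ⟨a, ha, rfl⟩ | ⟨a, ha, rfl⟩
    · exact Or.inl ⟨a, ⟨ha, hz⟩, rfl⟩
    · exact Or.inr ⟨a, ⟨ha, hz⟩, rfl⟩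
  · rintro (⟨a, ⟨-, ha⟩, rfl⟩ | ⟨a, ⟨-, ha⟩, rfl⟩) <;> exact ha

/-- Woodall's inequality for subsets of the discrete cube, with `α = log 3 / log 4`. -/
theorem card_mul_card_rpow_le_card_sub {α : ℝ} (h1 : 1 / 2 ≤ α) (h2 : α < 1)
    (h4 : (4 : ℝ) ^ α = 3) (m : ℕ) : ∀ A B : Finset ℤ, A ⊆ ternaryCube m → B ⊆ ternaryCube m →
      ((A.card : ℝ) * B.card) ^ α ≤ (A - B).card := by
  induction m with
  | zero =>
    intro A B hA hB
    have hα : α ≠ 0 := by linarith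
    rcases subset_singleton_iff.1 hA with rfl | rfl
    · simp [Real.zero_rpow hα]
    rcases subset_singleton_iff.1 hB with rfl | rfl
    · simp [Real.zero_rpow hα]
    · simp
  | succ m ih =>
    intro A B hA hB
    obtain ⟨A₀, hA₀, A₁, hA₁, hA'⟩ := exists_eq_image_union_of_subset_ternaryCube hA
    obtain ⟨B₀, hB₀, B₁, hB₁, hB'⟩ := exists_eq_image_union_of_subset_ternaryCube hB
    have cA : (A.card : ℝ) = A₀.card + A₁.card := by
      rw [hA', card_image_three_mul_union]; push_cast; rfl
    have cB : (B.card : ℝ) = B₀.card + B₁.card := by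
      rw [hB', card_image_three_mul_union]; push_cast; rfl
    have i01 := ih A₀ B₁ hA₀ hB₁
    have i10 := ih A₁ B₀ hA₁ hB₀
    rw [cA, cB]
    rcases le_total ((A₁.card : ℝ) * B₁.card) (A₀.card * B₀.card) with hle | hle
    · have hc : ((A₀ - B₀).card : ℝ) + (A₀ - B₁).card + (A₁ - B₀).card ≤ (A - B).card := by
        exact_mod_cast card_sub_add_card_sub_add_card_sub_le hA' hB' (Or.inl rfl)
      have := add_mul_add_rpow_le h1 h2 h4 (Nat.cast_nonneg _) (Nat.cast_nonneg _)
        (Nat.cast_nonneg _) (Nat.cast_nonneg _) hle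
      have := ih A₀ B₀ hA₀ hB₀
      linarith
    · have hc : ((A₁ - B₁).card : ℝ) + (A₀ - B₁).card + (A₁ - B₀).card ≤ (A - B).card := by
        exact_mod_cast card_sub_add_card_sub_add_card_sub_le hA' hB' (Or.inr rfl)
      have := add_mul_add_rpow_le h1 h2 h4 (Nat.cast_nonneg _) (Nat.cast_nonneg _)
        (Nat.cast_nonneg _) (Nat.cast_nonneg _) hle
      have := ih A₁ B₁ hA₁ hB₁
      rw [add_comm (A₀.card : ℝ), add_comm (B₀.card : ℝ)]
      linarith

theorem three_pow_le_card_sub {j m : ℕ} {A : Finset ℤ} (hA : A ⊆ ternaryCube m)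
    (hcard : A.card = 2 ^ j) : 3 ^ j ≤ (A - A).card := by
  have hlog4 : 0 < Real.log 4 := Real.log_pos (by norm_num)
  have h4 : (4 : ℝ) ^ (Real.log 3 / Real.log 4) = 3 := by
    rw [Real.rpow_def_of_pos (by norm_num), mul_div_cancel₀ _ hlog4.ne',
      Real.exp_log (by norm_num)]
  have h1 : 1 / 2 ≤ Real.log 3 / Real.log 4 := by
    have : Real.log 4 ≤ Real.log (3 ^ 2) := Real.log_le_log (by norm_num) (by norm_num)
    rw [Real.log_pow] at this
    rw [le_div_iff₀ hlog4]
    push_cast at this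
    linarith
  have h2 : Real.log 3 / Real.log 4 < 1 := by
    rw [div_lt_one hlog4]
    exact Real.log_lt_log (by norm_num) (by norm_num)
  have h := card_mul_card_rpow_le_card_sub h1 h2 h4 m A A hA hA
  rw [hcard] at h
  push_cast at h
  rw [← mul_pow, show (2 : ℝ) * 2 = 4 by norm_num, ← Real.rpow_natCast 4, ← Real.rpow_mul
    (by norm_num), mul_comm, Real.rpow_mul (by norm_num), h4, Real.rpow_natCast] at h
  exact_mod_cast h

theorem card_sub_self_eq_two_mul_card_diffSet_add_one {A : Finset ℝ} (hA : A.Nonempty) :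
    (A - A).card = 2 * (diffSet A).card + 1 := by
  have hneg : ((A - A).filter (fun x => x < 0)) = (diffSet A).image (fun x => -x) := by
    have hs : ∀ x ∈ A - A, -x ∈ A - A := by
      intro x hx
      obtain ⟨a, ha, b, hb, rfl⟩ := mem_sub.1 hx
      exact mem_sub.2 ⟨b, hb, a, ha, by ring⟩
    ext x
    simp only [diffSet, mem_filter, mem_image]
    constructor
    · rintro ⟨hx, h0⟩
      exact ⟨-x, ⟨hs x hx, by linarith⟩, by ring⟩
    · rintro ⟨y, ⟨hy, h0⟩, rfl⟩
      exact ⟨hs y hy, by linarith⟩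
  have hzero : ((A - A).filter (fun x => x = 0)) = {0} := by
    obtain ⟨a, ha⟩ := hA
    have : (0 : ℝ) ∈ A - A := mem_sub.2 ⟨a, ha, a, ha, sub_self a⟩
    ext x
    simp only [mem_filter, mem_singleton]
    exact ⟨fun h => h.2, fun h => ⟨h ▸ this, h⟩⟩
  have hunion : A - A = ((A - A).filter (fun x => x < 0) ∪ diffSet A) ∪
      (A - A).filter (fun x => x = 0) := by
    ext x
    simp only [diffSet, mem_union, mem_filter]
    have := lt_trichotomy x 0
    tauto
  have hcneg : ((A - A).filter (fun x => x < 0)).card = (diffSet A).card := by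
    rw [hneg, card_image_of_injective _ neg_injective]
  rw [hunion, card_union_of_disjoint, card_union_of_disjoint, hcneg, hzero, card_singleton]
  · ring
  · simp only [diffSet, disjoint_left, mem_filter]
    rintro x ⟨-, h⟩ ⟨-, h'⟩
    linarith
  · simp only [diffSet, disjoint_left, mem_filter, mem_union]
    rintro x (⟨-, h⟩ | ⟨-, h⟩) ⟨-, h'⟩ <;> linarith

theorem card_image_intCast_sub (A : Finset ℤ) :
    (A.image ((↑) : ℤ → ℝ) - A.image ((↑) : ℤ → ℝ)).card = (A - A).card := by
  rw [← card_image_of_injective (A - A) (Int.cast_injective (α := ℝ))]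
  congr 1
  exact (image_image₂_distrib Int.cast_sub).symm

/-- For `n = 2^m` and `k = 2^j` powers of two with `k < n`,
`g(n, k, (k^{log₂3} − 1)/2) = g(2^m, 2^j, (3^j − 1)/2) ≤ (3^m − 1)/2 = O(n^{log₂3})`. -/
theorem g_upper_cube (j m : ℕ) (hjm : j < m) :
    ∃ A : Finset ℝ, A.card = 2 ^ m ∧ LocalProp A (2 ^ j) ((3 ^ j - 1) / 2) ∧
      (diffSet A).card ≤ (3 ^ m - 1) / 2 := by
  have hcard : ((ternaryCube m).image ((↑) : ℤ → ℝ)).card = 2 ^ m := by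
    rw [card_image_of_injective _ Int.cast_injective, card_ternaryCube]
  refine ⟨(ternaryCube m).image ((↑) : ℤ → ℝ), hcard, ?_, ?_⟩
  · intro A' hA' hc
    obtain ⟨S, hS, rfl⟩ := subset_image_iff.1 hA'
    have h := card_sub_self_eq_two_mul_card_diffSet_add_one
      (card_pos.1 (hc ▸ Nat.two_pow_pos j))
    rw [card_image_of_injective _ Int.cast_injective] at hc
    have h3 := three_pow_le_card_sub hS hc
    rw [card_image_intCast_sub] at h
    lia
  · have h := card_sub_self_eq_two_mul_card_diffSet_add_one
      (card_pos.1 (hcard ▸ Nat.two_pow_pos m))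
    have h3 := card_ternaryCube_sub_le m
    rw [card_image_intCast_sub] at h
    lia
end

section
/- For all integers b ≥ 2 and i ≥ 1, there exists a finite set A ⊆ ℝ with |A| = b^i and |A − A| = ((2b−1)^i − 1)/2. -/
open Finset Pointwise

lemma image_addMonoidHom_sub {G H : Type*} [AddGroup G] [AddGroup H] [DecidableEq G]
    [DecidableEq H] (f : G →+ H) (s t : Finset G) :
    (s - t).image f = s.image f - t.image f :=
  image_image₂_distrib (map_sub f)

/-- A set of integers of diameter less than `m` and any set of multiples of `m` have a direct
sum. -/
lemma card_add_image_mul {m : ℤ} {S : Finset ℤ} (hS : ∀ x ∈ S, ∀ y ∈ S, x - y < m)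
    (hm : m ≠ 0) (T : Finset ℤ) : (S + T.image (AddMonoidHom.mulLeft m)).card = S.card * T.card := by
  have hinj : Function.Injective (AddMonoidHom.mulLeft m) := fun x y h => by
    simpa [hm] using h
  rw [← card_image_of_injective T hinj, card_add_iff]
  rintro ⟨x, u⟩ hx ⟨y, v⟩ hy h
  simp only [coe_image, Set.mem_prod, mem_coe, Set.mem_image, AddMonoidHom.coe_mulLeft] at hx hy
  obtain ⟨hx, t, -, rfl⟩ := hx
  obtain ⟨hy, s, -, rfl⟩ := hy
  have hd : m ∣ x - y := ⟨s - t, by simp only at h; linarith⟩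
  have hxy : x - y = 0 := Int.eq_zero_of_abs_lt_dvd hd <| by
    have := hS x hx y hy
    have := hS y hy x hx
    rw [abs_lt]
    constructor <;> linarith
  simp only [Prod.mk.injEq] at h ⊢
  constructor <;> linarith

lemma Ico_zero_sub_Ico_zero (b : ℤ) : Ico 0 b - Ico 0 b = Ioo (-b) b := by
  ext x
  simp only [mem_sub, mem_Ico, mem_Ioo]
  constructor
  · rintro ⟨y, hy, z, hz, rfl⟩
    omega
  · intro hx
    exact ⟨max x 0, by omega, max x 0 - x, by omega, by omega⟩

lemma exists_int_cube {b : ℕ} (hb : 1 ≤ b) (i : ℕ) :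
    ∃ A : Finset ℤ, A.card = b ^ i ∧ (A - A).card = (2 * b - 1) ^ i := by
  induction i with
  | zero => exact ⟨{0}, by simp⟩
  | succ i ih =>
    obtain ⟨A, hA, hAA⟩ := ih
    refine ⟨Ico 0 (b : ℤ) + A.image (AddMonoidHom.mulLeft (2 * b - 1 : ℤ)), ?_, ?_⟩
    · rw [card_add_image_mul _ (by omega), hA, Int.card_Ico, pow_succ']
      · simp
      · intro x hx y hy
        rw [mem_Ico] at hx hy
        omega
    · rw [add_sub_add_comm, ← image_addMonoidHom_sub, Ico_zero_sub_Ico_zero,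
        card_add_image_mul _ (by omega), hAA, Int.card_Ioo, pow_succ']
      · congr 1
        omega
      · intro x hx y hy
        rw [mem_Ioo] at hx hy
        omega

lemma two_mul_card_diffSet_add_one {A : Finset ℝ} (hA : A.Nonempty) :
    2 * (diffSet A).card + 1 = (A - A).card := by
  have hneg : ((A - A).filter (fun x => x < 0)).card = (diffSet A).card := by
    rw [← card_neg (diffSet A)]
    congr 1
    ext x
    rw [mem_neg', diffSet, mem_filter, mem_filter, ← mem_neg', neg_sub, neg_pos]
  have hzero : (A - A).filter (fun x => x = 0) = {0} := by
    rw [filter_eq', if_pos]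
    obtain ⟨a, ha⟩ := hA
    exact mem_sub.2 ⟨a, ha, a, ha, sub_self a⟩
  have hle : (A - A).filter (fun x => ¬ 0 < x) =
      (A - A).filter (fun x => x < 0) ∪ (A - A).filter (fun x => x = 0) := by
    rw [← filter_or]
    exact filter_congr fun x _ => by rw [not_lt, le_iff_lt_or_eq]
  rw [← card_filter_add_card_filter_not (s := A - A) (fun x => 0 < x), hle,
    card_union_of_disjoint, hneg, hzero, card_singleton, diffSet]
  · ring
  · exact disjoint_filter.2 fun x _ h => h.ne

/-- For all integers `b ≥ 2` and `i ≥ 1`, there is a finite set `A ⊆ ℝ` with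
`|A| = b^i` and `|A − A| = ((2b−1)^i − 1)/2`. -/
theorem exists_bary_cube (b i : ℕ) (hb : 2 ≤ b) (hi : 1 ≤ i) :
    ∃ A : Finset ℝ, A.card = b ^ i ∧
      (diffSet A).card = ((2 * b - 1) ^ i - 1) / 2 := by
  obtain ⟨A, hA, hAA⟩ := exists_int_cube (b := b) (by omega) i
  have hinj : Function.Injective (Int.castAddHom ℝ) := Int.cast_injective
  have hne : A.Nonempty := card_pos.1 (hA ▸ by positivity)
  refine ⟨A.image (Int.castAddHom ℝ), by rw [card_image_of_injective _ hinj, hA], ?_⟩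
  have h := two_mul_card_diffSet_add_one (hne.image (Int.castAddHom ℝ))
  rw [← image_addMonoidHom_sub, card_image_of_injective _ hinj, hAA] at h
  omega
end

section
/- Let m ≥ 3 be an integer and set k = 2^m. For every integer i with 1 ≤ i ≤ m − 2 there exists n₀ such that for every integer n ≥ n₀ the following holds: every set A of n distinct real numbers with |A − A| ≤ n^{1 + 2/(k−2)}/9 contains at least n^{1 − (2^{i+1} − 2)/(k−2)} pairwise disjoint subsets, each of which is a translate of one common projected-i-cube having exactly 2^i elements. -/
open Finset Pointwise

/-- The projected-`i`-cube `P(a, δ₁, …, δᵢ) = {a + x₁δ₁ + ⋯ + xᵢδᵢ : x₁,…,xᵢ ∈ {0,1}}`. -/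
noncomputable def projCube (i : ℕ) (a : ℝ) (δ : Fin i → ℝ) : Finset ℝ :=
  Finset.image (fun x : Fin i → Bool => a + ∑ j, if x j then δ j else 0) Finset.univ

theorem projCube_zero (a : ℝ) (δ : Fin 0 → ℝ) : projCube 0 a δ = {a} := by
  simp [projCube]

theorem mem_projCube_self (i : ℕ) (a : ℝ) (δ : Fin i → ℝ) : a ∈ projCube i a δ := by
  simp only [projCube, mem_image, mem_univ, true_and]
  exact ⟨fun _ => false, by simp⟩

theorem projCube_cons (i : ℕ) (a d : ℝ) (δ : Fin i → ℝ) :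
    projCube (i + 1) a (Fin.cons d δ) = projCube i a δ ∪ projCube i (a + d) δ := by
  ext y
  simp only [projCube, mem_image, mem_univ, true_and, mem_union, Fin.sum_univ_succ,
    Fin.cons_zero, Fin.cons_succ]
  constructor
  · rintro ⟨x, rfl⟩
    cases h : x 0
    · exact Or.inl ⟨fun j => x j.succ, by simp⟩
    · exact Or.inr ⟨fun j => x j.succ, by simp [add_assoc]⟩
  · rintro (⟨x, rfl⟩ | ⟨x, rfl⟩)
    · exact ⟨Fin.cons false x, by simp⟩
    · exact ⟨Fin.cons true x, by simp [add_assoc]⟩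

/-- A finite set of reals has a subset of at least half its size that contains no two elements
at distance exactly `d`: colour `x` by the parity of `⌊x / d⌋`. -/
theorem exists_subset_card_le_two_mul_forall_add_notMem (P : Finset ℝ) {d : ℝ} (hd : 0 < d) :
    ∃ Q ⊆ P, P.card ≤ 2 * Q.card ∧ ∀ x ∈ Q, x + d ∉ Q := by
  have hfloor (x : ℝ) : ⌊(x + d) / d⌋ = ⌊x / d⌋ + 1 := by
    rw [add_div, div_self hd.ne', Int.floor_add_one]
  have hcard := card_filter_add_card_filter_not (s := P) (fun x => Even ⌊x / d⌋)
  rcases le_total (P.filter fun x => Even ⌊x / d⌋).card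
    (P.filter fun x => ¬ Even ⌊x / d⌋).card with h | h
  · refine ⟨P.filter fun x => ¬ Even ⌊x / d⌋, filter_subset _ _, by omega, fun x hx hx' => ?_⟩
    rw [mem_filter] at hx hx'
    rw [hfloor, Int.even_add_one] at hx'
    exact hx'.2 hx.2
  · refine ⟨P.filter fun x => Even ⌊x / d⌋, filter_subset _ _, by omega, fun x hx hx' => ?_⟩
    rw [mem_filter] at hx hx'
    rw [hfloor, Int.even_add_one] at hx'
    exact hx'.2 hx.2

/-- If all positive differences of `S` lie in `D`, some difference is attained by many pairwise
disjoint pairs of elements of `S`. -/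
theorem exists_popular_difference_s18 {S D : Finset ℝ} (hS : 2 ≤ S.card)
    (hD : ∀ x ∈ S, ∀ y ∈ S, x < y → y - x ∈ D) (hpos : ∀ d ∈ D, 0 < d) :
    ∃ d > 0, ∃ Q ⊆ S, (S.card : ℝ) ^ 2 ≤ 8 * D.card * Q.card ∧
      ∀ x ∈ Q, x + d ∈ S ∧ x + d ∉ Q := by
  have hmaps : ∀ p ∈ S.offDiag, |p.1 - p.2| ∈ D := by
    rintro ⟨x, y⟩ hp
    obtain ⟨hx, hy, hxy⟩ := mem_offDiag.1 hp
    rcases lt_or_gt_of_ne hxy with h | h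
    · rw [abs_sub_comm, abs_of_pos (sub_pos.2 h)]
      exact hD x hx y hy h
    · rw [abs_of_pos (sub_pos.2 h)]
      exact hD y hy x hx h
  have hne : D.Nonempty := by
    obtain ⟨x, hx, y, hy, hxy⟩ := one_lt_card.1 hS
    exact ⟨_, hmaps (x, y) (mem_offDiag.2 ⟨hx, hy, hxy⟩)⟩
  have hD0 : (0 : ℝ) < D.card := by exact_mod_cast hne.card_pos
  obtain ⟨d, hdD, hd⟩ := exists_le_card_fiber_of_nsmul_le_card_of_maps_to
    (b := (S.offDiag.card : ℝ) / D.card) hmaps hne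
    (by rw [nsmul_eq_mul, mul_div_cancel₀ _ hD0.ne'])
  have hd0 := hpos d hdD
  obtain ⟨Q, hQP, hPQ, hQ⟩ :=
    exists_subset_card_le_two_mul_forall_add_notMem (S.filter fun x => x + d ∈ S) hd0
  refine ⟨d, hd0, Q, hQP.trans (filter_subset _ _), ?_, fun x hx =>
    ⟨(mem_filter.1 (hQP hx)).2, hQ x hx⟩⟩
  set P := S.filter fun x => x + d ∈ S with hP
  have hfiber : (S.offDiag.filter fun p => |p.1 - p.2| = d).card ≤ 2 * P.card := by
    have hsub : (S.offDiag.filter fun p => |p.1 - p.2| = d) ⊆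
        P.image (fun x => (x, x + d)) ∪ P.image (fun x => (x + d, x)) := by
      rintro ⟨x, y⟩ hp
      simp only [mem_filter, mem_offDiag] at hp
      obtain ⟨⟨hx, hy, -⟩, hxy⟩ := hp
      simp only [mem_union, mem_image, hP, mem_filter, Prod.mk.injEq]
      rcases (abs_eq hd0.le).1 hxy with h | h
      · obtain rfl : x = y + d := by linarith
        exact Or.inr ⟨y, ⟨hy, hx⟩, rfl, rfl⟩
      · obtain rfl : y = x + d := by linarith
        exact Or.inl ⟨x, ⟨hx, hy⟩, rfl, rfl⟩
    calc _ ≤ _ := card_le_card hsub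
      _ ≤ _ := card_union_le _ _
      _ ≤ P.card + P.card := add_le_add card_image_le card_image_le
      _ = 2 * P.card := by ring
  have hoff : (S.offDiag.card : ℝ) = S.card ^ 2 - S.card := by
    rw [offDiag_card, Nat.cast_sub (Nat.le_mul_self _)]
    push_cast
    ring
  have h4 : ((S.offDiag.filter fun p => |p.1 - p.2| = d).card : ℝ) ≤ 4 * Q.card := by
    exact_mod_cast (by omega : _ ≤ 4 * Q.card)
  have hmain := (div_le_iff₀ hD0).1 (hd.trans h4)
  have hS' : (2 : ℝ) ≤ S.card := by exact_mod_cast hS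
  nlinarith

/-- The cube family at dimension `i`, in terms of the set `S` of base points of the cubes. -/
theorem exists_disjoint_projCubes_base (m n : ℕ) (hm : 3 ≤ m) (hn : 2 ≤ n) (A : Finset ℝ)
    (hA : A.card = n)
    (hdiff : ((diffSet A).card : ℝ) ≤ (n : ℝ) ^ ((1 : ℝ) + 2 / ((2 ^ m : ℝ) - 2)) / 9)
    (i : ℕ) (hi : i ≤ m - 1) :
    ∃ (δ : Fin i → ℝ) (S : Finset ℝ), (∀ j, 0 < δ j) ∧
      (n : ℝ) ^ ((1 : ℝ) - ((2 ^ (i + 1) : ℝ) - 2) / ((2 ^ m : ℝ) - 2)) ≤ S.card ∧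
      (∀ s ∈ S, projCube i s δ ⊆ A ∧ (projCube i s δ).card = 2 ^ i) ∧
      (∀ s ∈ S, ∀ s' ∈ S, s ≠ s' → Disjoint (projCube i s δ) (projCube i s' δ)) := by
  induction i with
  | zero =>
    refine ⟨Fin.elim0, A, fun j => j.elim0, ?_, ?_, ?_⟩
    · simp [hA]
    · intro s hs
      simpa [projCube_zero] using hs
    · intro s _ s' _ h
      simpa [projCube_zero] using h
  | succ i ih =>
    obtain ⟨δ, S, hδ, hcard, hcube, hdisj⟩ := ih (by omega)
    have hn1 : (1 : ℝ) < n := by exact_mod_cast hn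
    have hn0 : (0 : ℝ) < n := by linarith
    have hK : (2 : ℝ) ^ (i + 1) < 2 ^ m := pow_lt_pow_right₀ one_lt_two (by omega)
    have hK2 : (2 : ℝ) < 2 ^ m := by
      simpa using pow_lt_pow_right₀ (one_lt_two (α := ℝ)) (by omega : 1 < m)
    have hexp : 0 < (1 : ℝ) - ((2 ^ (i + 1) : ℝ) - 2) / ((2 ^ m : ℝ) - 2) := by
      rw [sub_pos, div_lt_one (by linarith)]
      linarith
    have hS : 2 ≤ S.card := by
      have := (Real.one_lt_rpow hn1 hexp).trans_le hcard
      exact_mod_cast this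
    have hSA : S ⊆ A := fun s hs => (hcube s hs).1 (mem_projCube_self i s δ)
    obtain ⟨d, hd, Q, hQS, hQcard, hQ⟩ := exists_popular_difference_s18 (D := diffSet A) hS
      (fun x hx y hy hxy => mem_filter.2 ⟨sub_mem_sub (hSA hy) (hSA hx), sub_pos.2 hxy⟩)
      (fun d hd => (mem_filter.1 hd).2)
    refine ⟨Fin.cons d δ, Q, Fin.cases hd hδ, ?_, ?_, ?_⟩
    · set e := (1 : ℝ) - ((2 ^ (i + 1) : ℝ) - 2) / ((2 ^ m : ℝ) - 2) with he
      set r := (1 : ℝ) + 2 / ((2 ^ m : ℝ) - 2) with hr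
      have hsum : (1 : ℝ) - ((2 ^ (i + 1 + 1) : ℝ) - 2) / ((2 ^ m : ℝ) - 2) = e + e - r := by
        have : (2 : ℝ) ^ m - 2 ≠ 0 := by linarith
        rw [he, hr]
        field_simp
        ring
      rw [hsum, Real.rpow_sub hn0, Real.rpow_add hn0, div_le_iff₀ (Real.rpow_pos_of_pos hn0 r)]
      have hsq := mul_self_le_mul_self (Real.rpow_pos_of_pos hn0 e).le hcard
      have hr0 := Real.rpow_pos_of_pos hn0 r
      have hQ0 : (0 : ℝ) ≤ Q.card := by positivity
      have := mul_le_mul_of_nonneg_right hdiff hQ0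
      nlinarith [mul_nonneg hQ0 hr0.le]
    · intro s hs
      have hne : s ≠ s + d := by linarith
      rw [projCube_cons, card_union_of_disjoint (hdisj s (hQS hs) _ (hQ s hs).1 hne),
        (hcube s (hQS hs)).2, (hcube _ (hQ s hs).1).2]
      exact ⟨union_subset (hcube s (hQS hs)).1 (hcube _ (hQ s hs).1).1, by ring⟩
    · intro s hs s' hs' hne
      rw [projCube_cons, projCube_cons]
      simp only [disjoint_union_left, disjoint_union_right]
      refine ⟨⟨hdisj _ (hQS hs) _ (hQS hs') hne, hdisj _ (hQ s hs).1 _ (hQS hs') ?_⟩,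
        hdisj _ (hQS hs) _ (hQ s' hs').1 ?_, hdisj _ (hQ s hs).1 _ (hQ s' hs').1 ?_⟩
      · rintro rfl
        exact (hQ s hs).2 hs'
      · rintro rfl
        exact (hQ s' hs').2 hs
      · simpa using hne

/-- For `k = 2^m` with `m ≥ 3` and `1 ≤ i ≤ m − 2`: for all sufficiently large `n`, every
`n`-element set `A ⊆ ℝ` with `|A − A| ≤ n^{1 + 2/(k−2)}/9` contains at least
`n^{1 − (2^{i+1} − 2)/(k−2)}` pairwise disjoint translated copies of a common
projected-`i`-cube having exactly `2^i` elements. -/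
theorem many_disjoint_projCubes (m : ℕ) (hm : 3 ≤ m) (i : ℕ)
    (hi1 : 1 ≤ i) (hi2 : i ≤ m - 2) :
    ∃ n₀ : ℕ, ∀ n : ℕ, n₀ ≤ n → ∀ A : Finset ℝ, A.card = n →
      ((diffSet A).card : ℝ) ≤ (n : ℝ) ^ ((1 : ℝ) + 2 / ((2 ^ m : ℝ) - 2)) / 9 →
      ∃ (a : ℝ) (δ : Fin i → ℝ) (T : Finset ℝ),
        0 < a ∧ (∀ j, 0 < δ j) ∧
        (n : ℝ) ^ ((1 : ℝ) - ((2 ^ (i + 1) : ℝ) - 2) / ((2 ^ m : ℝ) - 2)) ≤ T.card ∧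
        (∀ t ∈ T, projCube i (a + t) δ ⊆ A ∧ (projCube i (a + t) δ).card = 2 ^ i) ∧
        (∀ t ∈ T, ∀ t' ∈ T, t ≠ t' →
          Disjoint (projCube i (a + t) δ) (projCube i (a + t') δ)) := by
  refine ⟨2, fun n hn A hA hdiff => ?_⟩
  obtain ⟨δ, S, hδ, hcard, hcube, hdisj⟩ :=
    exists_disjoint_projCubes_base m n hm hn A hA hdiff i (by omega)
  have hmem : ∀ t ∈ S.image (fun s => s - 1), 1 + t ∈ S := by
    intro t ht
    obtain ⟨s, hs, rfl⟩ := mem_image.1 ht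
    simpa using hs
  refine ⟨1, δ, S.image (fun s => s - 1), one_pos, hδ, ?_, fun t ht => hcube _ (hmem t ht),
    fun t ht t' ht' hne => hdisj _ (hmem t ht) _ (hmem t' ht') (by simpa using hne)⟩
  rwa [card_image_of_injective _ (sub_left_injective)]
end
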